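/- Under the featured correlated Gaussian Wigner model G(n,d,ρ,r), assume there is a universal constant Γ with 1/Γ ≤ Edge/Vertex ≤ Γ, where Edge = n·log(1/(1−ρ²)) and Vertex = d·log(1/(1−r²)). For any constant δ ∈ (0,1/2): if d = ω(log n) and n·log(1/(1−ρ²)) + d·log(1/(1−r²)) ≥ C0·log n for some constant C0 = C0(δ,Γ) depending only on δ and Γ, then for the estimator π̂_λ ∈ argmax_{π∈S_n} { λ·Σ_{e∈E(G1)} β_e(G1)·β_{π(e)}(G2) + (1−λ)·Σ_{v∈V(G1)} x_v^⊤ y_{π(v)} }, we have P[π̂_λ ≠ π*] = o(1) as n → ∞, for every λ ∈ (δ, 1−δ). -/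

import Mathlib

open MeasureTheory ProbabilityTheory Filter
open scoped ENNReal

namespace FCGW

/-- `phi x = x / (1 - x^2)`, the weight function `φ` from the paper. -/
noncomputable def phi (x : ℝ) : ℝ := x / (1 - x ^ 2)

/-- The edge set of the complete graph on `Fin n`: non-diagonal unordered pairs. -/
abbrev Edge (n : ℕ) := {e : Sym2 (Fin n) // ¬ e.IsDiag}

lemma map_not_isDiag {n : ℕ} (π : Equiv.Perm (Fin n)) (e : Sym2 (Fin n)) :
    ¬ e.IsDiag → ¬ (Sym2.map π e).IsDiag := by
  induction e using Sym2.ind with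
  | _ x y =>
    simp only [Sym2.map_pair_eq, Sym2.mk_isDiag_iff]
    exact fun he h => he (π.injective h)

/-- Action of a vertex permutation on edges: `π({u,v}) = {π(u), π(v)}`. -/
def edgeMap {n : ℕ} (π : Equiv.Perm (Fin n)) (e : Edge n) : Edge n :=
  ⟨Sym2.map π e.1, map_not_isDiag π e.1 e.2⟩

/-- The observation space: edge weights of `G1`, edge weights of `G2`,
features of `G1`, features of `G2`. -/
abbrev Obs (n d : ℕ) :=
  (Edge n → ℝ) × (Edge n → ℝ) × (Fin n → Fin d → ℝ) × (Fin n → Fin d → ℝ)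

/-- The law of a pair of jointly Gaussian standard normals with correlation `ρ`,
i.e. a centered Gaussian vector in `ℝ²` with covariance `[[1, ρ], [ρ, 1]]`. -/
noncomputable def gaussianPair (ρ : ℝ) : Measure (ℝ × ℝ) :=
  Measure.map (fun z : ℝ × ℝ => (z.1, ρ * z.1 + Real.sqrt (1 - ρ ^ 2) * z.2))
    ((gaussianReal 0 1).prod (gaussianReal 0 1))

/-- The law `N(0, Σ_d)` with `Σ_d = [[I_d, r I_d], [r I_d, I_d]]` of a correlated
feature pair `(x, y) ∈ ℝ^d × ℝ^d`. -/
noncomputable def featurePair (d : ℕ) (r : ℝ) : Measure ((Fin d → ℝ) × (Fin d → ℝ)) :=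
  Measure.map (fun z : (Fin d → ℝ) × (Fin d → ℝ) =>
      (z.1, fun i => r * z.1 i + Real.sqrt (1 - r ^ 2) * z.2 i))
    ((Measure.pi fun _ : Fin d => gaussianReal 0 1).prod
      (Measure.pi fun _ : Fin d => gaussianReal 0 1))

/-- The underlying randomness of the featured correlated Gaussian Wigner model:
independent correlated Gaussian pairs for each edge of `G1` and independent
correlated feature pairs for each vertex of `G1`. -/
noncomputable def sample (n d : ℕ) (ρ r : ℝ) :
    Measure ((Edge n → ℝ × ℝ) × (Fin n → (Fin d → ℝ) × (Fin d → ℝ))) :=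
  (Measure.pi fun _ : Edge n => gaussianPair ρ).prod
    (Measure.pi fun _ : Fin n => featurePair d r)

/-- The observations `(β(G1), β(G2), x, y)` produced from the underlying
randomness when the latent vertex correspondence is `πs`: the pair at edge `e`
gives the weight of `e` in `G1` and of `πs(e)` in `G2`, and the feature pair at a
vertex `v` gives the feature of `v` in `G1` and of `πs(v)` in `G2`. -/
noncomputable def obsOf {n d : ℕ} (πs : Equiv.Perm (Fin n))
    (ω : (Edge n → ℝ × ℝ) × (Fin n → (Fin d → ℝ) × (Fin d → ℝ))) : Obs n d :=
  (fun e => (ω.1 e).1,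
   fun f => (ω.1 (edgeMap πs⁻¹ f)).2,
   fun v => (ω.2 v).1,
   fun v => (ω.2 (πs⁻¹ v)).2)

/-- The law of the observed pair of featured graphs `(G1, G2)` under the featured
correlated Gaussian Wigner model `G(n, d, ρ, r)` with latent correspondence `πs`. -/
noncomputable def obsLaw (n d : ℕ) (ρ r : ℝ) (πs : Equiv.Perm (Fin n)) :
    Measure (Obs n d) :=
  Measure.map (obsOf πs) (sample n d ρ r)

/-- The similarity score
`S_π = φ(ρ) Σ_e β_e(G1) β_{π(e)}(G2) + φ(r) Σ_v ⟪x_v, y_{π(v)}⟫`. -/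
noncomputable def score {n d : ℕ} (ρ r : ℝ) (o : Obs n d) (π : Equiv.Perm (Fin n)) : ℝ :=
  phi ρ * ∑ e : Edge n, o.1 e * o.2.1 (edgeMap π e)
    + phi r * ∑ v : Fin n, ∑ i : Fin d, o.2.2.1 v i * o.2.2.2 (π v) i

/-- `overlap(π, π') = |{v : π v = π' v}| / n`. -/
noncomputable def overlap {n : ℕ} (π π' : Equiv.Perm (Fin n)) : ℝ :=
  ((Finset.univ.filter fun v => π v = π' v).card : ℝ) / n

/-- The Hamming distance `d(π, π') = |{v : π v ≠ π' v}|`. -/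
def hamming {n : ℕ} (π π' : Equiv.Perm (Fin n)) : ℕ :=
  (Finset.univ.filter fun v => π v ≠ π' v).card

instance {n : ℕ} : MeasurableSpace (Equiv.Perm (Fin n)) := ⊤

/-- The Bayesian joint law of `(π*, (G1, G2))` when `π*` is uniform on `S_n`. -/
noncomputable def bayesLaw (n d : ℕ) (ρ r : ℝ) :
    Measure (Equiv.Perm (Fin n) × Obs n d) :=
  (Nat.factorial n : ℝ≥0∞)⁻¹ •
    ∑ π : Equiv.Perm (Fin n), Measure.map (fun o => (π, o)) (obsLaw n d ρ r π)

/-- The `λ`-weighted similarity score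
`λ Σ_e β_e(G1) β_{π(e)}(G2) + (1-λ) Σ_v ⟪x_v, y_{π(v)}⟫`. -/
noncomputable def scoreLam {n d : ℕ} (lam : ℝ) (o : Obs n d) (π : Equiv.Perm (Fin n)) : ℝ :=
  lam * ∑ e : Edge n, o.1 e * o.2.1 (edgeMap π e)
    + (1 - lam) * ∑ v : Fin n, ∑ i : Fin d, o.2.2.1 v i * o.2.2.2 (π v) i

lemma gauss_sq (s c : ℝ) (hs : 0 ≤ s) :
    ∫⁻ g, ENNReal.ofReal (Real.exp (-s * (g - c) ^ 2)) ∂(gaussianReal 0 1)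
      ≤ ENNReal.ofReal ((Real.sqrt (1 + 2 * s))⁻¹) := by
  have h1 : 0 < 1 + 2 * s := by linarith
  set v : NNReal := ⟨(1 + 2 * s)⁻¹, by positivity⟩ with hv
  have hv0 : v ≠ 0 := by
    intro h
    have : (v : ℝ) = 0 := by rw [h]; rfl
    rw [hv] at this
    have h2 : (1 + 2 * s)⁻¹ = 0 := this
    have := inv_pos.2 h1
    linarith
  have hvc : (v : ℝ) = (1 + 2 * s)⁻¹ := rfl
  rw [gaussianReal_of_var_ne_zero 0 one_ne_zero,
    lintegral_withDensity_eq_lintegral_mul _ (measurable_gaussianPDF _ _) (by fun_prop)]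
  calc _ ≤ ∫⁻ g, ENNReal.ofReal ((Real.sqrt (1 + 2 * s))⁻¹) *
        ENNReal.ofReal (gaussianPDFReal (2 * s * c / (1 + 2 * s)) v g) := by
        apply lintegral_mono
        intro g
        simp only [Pi.mul_apply, gaussianPDF]
        rw [← ENNReal.ofReal_mul (gaussianPDFReal_nonneg _ _ _),
          ← ENNReal.ofReal_mul (by positivity)]
        apply ENNReal.ofReal_le_ofReal
        simp only [gaussianPDFReal, hvc]
        have e1 : Real.sqrt (2 * Real.pi * (1 + 2 * s)⁻¹)
            = Real.sqrt (2 * Real.pi) * (Real.sqrt (1 + 2 * s))⁻¹ := by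
          rw [Real.sqrt_mul (by positivity), Real.sqrt_inv]
        rw [e1]
        have h3 : 0 < Real.sqrt (1 + 2 * s) := Real.sqrt_pos.2 h1
        have h4 : 0 < Real.sqrt (2 * Real.pi) := Real.sqrt_pos.2 (by positivity)
        have e2 : (Real.sqrt (1 + 2 * s))⁻¹ * ((Real.sqrt (2 * Real.pi) * (Real.sqrt (1 + 2 * s))⁻¹)⁻¹ *
            Real.exp (-(g - 2 * s * c / (1 + 2 * s)) ^ 2 / (2 * (1 + 2 * s)⁻¹)))
            = (Real.sqrt (2 * Real.pi))⁻¹ * 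
            Real.exp (-(g - 2 * s * c / (1 + 2 * s)) ^ 2 / (2 * (1 + 2 * s)⁻¹)) := by
          field_simp
        rw [e2, mul_assoc, ← Real.exp_add]
        simp only [NNReal.coe_one, mul_one, sub_zero]
        gcongr
        have e3 : -(g - 2 * s * c / (1 + 2 * s)) ^ 2 / (2 * (1 + 2 * s)⁻¹)
          = (-g ^ 2 / 2 + -s * (g - c) ^ 2) + s * c ^ 2 / (1 + 2 * s) := by
          field_simp
          ring
        rw [e3]
        have : 0 ≤ s * c ^ 2 / (1 + 2 * s) := by positivity
        linarith
    _ = _ := by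
        rw [lintegral_const_mul _ (by fun_prop), lintegral_gaussianPDFReal_eq_one _ hv0, mul_one]

lemma gauss_mgf (c : ℝ) :
    ∫⁻ g, ENNReal.ofReal (Real.exp (c * g)) ∂(gaussianReal 0 1)
      = ENNReal.ofReal (Real.exp (c ^ 2 / 2)) := by
  rw [← ofReal_integral_eq_lintegral_ofReal (integrable_exp_mul_gaussianReal c)
    (ae_of_all _ fun _ => (Real.exp_pos _).le)]
  congr 1
  have := congrFun (mgf_id_gaussianReal (μ := 0) (v := 1)) c
  simpa [mgf] using this

lemma lint_pi_prod {α : Type*} [Fintype α] (μ : Measure ℝ) [IsProbabilityMeasure μ]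
    (f : α → ℝ → ℝ≥0∞) (hf : ∀ a, Measurable (f a)) :
    ∫⁻ x, ∏ a, f a (x a) ∂(Measure.pi fun _ : α => μ) = ∏ a, ∫⁻ g, f a g ∂μ := by
  have hind : iIndepFun (fun (a : α) (x : α → ℝ) => f a (x a)) (Measure.pi fun _ : α => μ) :=
    iIndepFun_pi (X := f) (fun a => (hf a).aemeasurable)
  have := lintegral_prod_eq_prod_lintegral_of_indepFun Finset.univ
    (fun (a : α) (x : α → ℝ) => f a (x a)) hind (fun a => (hf a).comp (measurable_pi_apply a))
  rw [this]
  refine Finset.prod_congr rfl fun a _ => ?_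
  exact (measurePreserving_eval (fun _ : α => μ) a).lintegral_comp (hf a)

lemma exists_matching {α : Type*} [Fintype α] [DecidableEq α] (σ : Equiv.Perm α) :
    ∃ S : Finset α, (∀ a ∈ S, σ a ∉ S) ∧
      (Finset.univ.filter fun a => σ a ≠ a).card ≤ 3 * S.card := by
  obtain ⟨S, hS, hmax⟩ := Finset.exists_max_image
    (Finset.univ.filter fun S : Finset α => ∀ a ∈ S, σ a ∉ S) Finset.card
    ⟨∅, by simp⟩
  simp only [Finset.mem_filter, Finset.mem_univ, true_and] at hS hmax
  refine ⟨S, hS, ?_⟩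
  have hsub : (Finset.univ.filter fun a => σ a ≠ a) ⊆
      S ∪ (S.image σ ∪ S.image σ.symm) := by
    intro a ha
    simp only [Finset.mem_filter, Finset.mem_univ, true_and] at ha
    by_contra hcon
    simp only [Finset.mem_union, Finset.mem_image, not_or, not_exists, not_and] at hcon
    obtain ⟨h1, h2, h3⟩ := hcon
    have := hmax (insert a S) (by
      intro b hb
      rw [Finset.mem_insert] at hb
      rw [Finset.mem_insert, not_or]
      rcases hb with rfl | hb
      · exact ⟨ha, fun h => h3 _ h (by simp)⟩
      · exact ⟨h2 b hb, hS b hb⟩)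
    rw [Finset.card_insert_of_notMem h1] at this
    omega
  have := Finset.card_le_card hsub
  have h1 := Finset.card_union_le S (S.image σ ∪ S.image σ.symm)
  have h2 := Finset.card_union_le (S.image σ) (S.image σ.symm)
  have h3 := Finset.card_image_le (s := S) (f := σ)
  have h4 := Finset.card_image_le (s := S) (f := σ.symm)
  omega

lemma gauss_D {α : Type*} [Fintype α] [DecidableEq α] (σ : Equiv.Perm α) (s : ℝ) (hs : 0 ≤ s)
    (S : Finset α) (hS : ∀ a ∈ S, σ a ∉ S) :
    ∫⁻ x : α → ℝ, ENNReal.ofReal (Real.exp (-s * ∑ a, (x a - x (σ a)) ^ 2))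
      ∂(Measure.pi fun _ : α => gaussianReal 0 1)
      ≤ ENNReal.ofReal ((Real.sqrt (1 + 2 * s))⁻¹) ^ S.card := by
  classical
  have hmp := measurePreserving_piEquivPiSubtypeProd (fun _ : α => gaussianReal 0 1) (fun a => a ∈ S)
  calc _ ≤ ∫⁻ x : α → ℝ, ∏ a : {a // a ∈ S}, ENNReal.ofReal (Real.exp (-s * (x a - x (σ a)) ^ 2))
      ∂(Measure.pi fun _ : α => gaussianReal 0 1) := by
        apply lintegral_mono
        intro x
        simp only
        rw [← ENNReal.ofReal_prod_of_nonneg (fun _ _ => (Real.exp_pos _).le), ← Real.exp_sum]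
        apply ENNReal.ofReal_le_ofReal
        apply Real.exp_le_exp.2
        rw [← Finset.mul_sum]
        have : ∑ a : {a // a ∈ S}, (x a - x (σ a)) ^ 2 ≤ ∑ a, (x a - x (σ a)) ^ 2 := by
          rw [Finset.sum_coe_sort S (fun a => (x a - x (σ a)) ^ 2)]
          exact Finset.sum_le_sum_of_subset_of_nonneg (Finset.subset_univ _)
            (fun _ _ _ => sq_nonneg _)
        nlinarith
    _ = ∫⁻ p : ({a // a ∈ S} → ℝ) × ({a // a ∉ S} → ℝ),
          ∏ a : {a // a ∈ S}, ENNReal.ofReal (Real.exp (-s * (p.1 a - p.2 ⟨σ a, hS a a.2⟩) ^ 2))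
        ∂((Measure.pi fun _ => gaussianReal 0 1).prod (Measure.pi fun _ => gaussianReal 0 1)) := by
        convert (hmp.lintegral_comp (f := fun p : ({a // a ∈ S} → ℝ) × ({a // a ∉ S} → ℝ) =>
          ∏ a : {a // a ∈ S}, ENNReal.ofReal (Real.exp (-s * (p.1 a - p.2 ⟨σ a, hS a a.2⟩) ^ 2)))
          (by fun_prop)) using 1
        congr 2
        all_goals (try congr!)
    _ ≤ _ := by
        rw [lintegral_prod_symm _ (by fun_prop)]
        calc _ ≤ ∫⁻ q : {a // a ∉ S} → ℝ, ENNReal.ofReal ((Real.sqrt (1 + 2 * s))⁻¹) ^ S.card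
              ∂(Measure.pi fun _ => gaussianReal 0 1) := by
              apply lintegral_mono
              intro q
              simp only
              rw [lint_pi_prod (gaussianReal 0 1) (fun (a : {a // a ∈ S}) g =>
                ENNReal.ofReal (Real.exp (-s * (g - q ⟨σ a, hS a a.2⟩) ^ 2))) (by fun_prop)]
              refine (Finset.prod_le_prod' (fun a _ => gauss_sq s _ hs)).trans ?_
              simp
          _ = _ := by simp

instance (ρ : ℝ) : IsProbabilityMeasure (gaussianPair ρ) :=
  Measure.isProbabilityMeasure_map (by fun_prop)

lemma pi_gaussianPair {α : Type*} [Fintype α] (ρ : ℝ) :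
    (Measure.pi fun _ : α => gaussianPair ρ) =
    Measure.map (fun p : (α → ℝ) × (α → ℝ) => fun a =>
      (p.1 a, ρ * p.1 a + Real.sqrt (1 - ρ ^ 2) * p.2 a))
      ((Measure.pi fun _ : α => gaussianReal 0 1).prod (Measure.pi fun _ : α => gaussianReal 0 1)) := by
  have h : (Measure.pi fun _ : α => gaussianPair ρ) = _ :=
    (Measure.pi_map_pi (μ := fun _ : α => (gaussianReal 0 1).prod (gaussianReal 0 1))
    (f := fun _ => (fun z : ℝ × ℝ => (z.1, ρ * z.1 + Real.sqrt (1 - ρ ^ 2) * z.2)))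
    (hμ := fun _ => by
      have : IsProbabilityMeasure (gaussianPair ρ) := inferInstance
      unfold gaussianPair at this
      infer_instance)
    (fun _ => by fun_prop)).symm
  rw [h, ← (measurePreserving_arrowProdEquivProdArrow ℝ ℝ α (fun _ => gaussianReal 0 1)
    (fun _ => gaussianReal 0 1)).map_eq, Measure.map_map (by fun_prop) (by fun_prop)]
  rfl

lemma core {α : Type*} [Fintype α] [DecidableEq α] (σ : Equiv.Perm α) (ρ : ℝ) (h0 : 0 < ρ)
    (h1 : ρ < 1) :
    (Measure.pi fun _ : α => gaussianPair ρ)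
      {w | ∑ a, (w a).1 * (w a).2 ≤ ∑ a, (w a).1 * (w (σ a)).2}
      ≤ ENNReal.ofReal (Real.exp (-(((Finset.univ.filter fun a => σ a ≠ a).card : ℝ) / 24
          * Real.log (1 / (1 - ρ ^ 2))))) := by
  obtain ⟨S, hS, hcard⟩ := exists_matching σ
  have hv : 0 < 1 - ρ ^ 2 := by nlinarith
  set τ := Real.sqrt (1 - ρ ^ 2) with hτ
  have hτ2 : τ ^ 2 = 1 - ρ ^ 2 := Real.sq_sqrt hv.le
  have hτ0 : 0 < τ := Real.sqrt_pos.2 hv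
  set t := ρ / (2 * τ ^ 2) with ht
  set s := ρ ^ 2 / (8 * τ ^ 2) with hs
  have hs0 : 0 ≤ s := by positivity
  have ht0 : 0 < t := by positivity
  have key : (Measure.pi fun _ : α => gaussianPair ρ)
      {w | ∑ a, (w a).1 * (w a).2 ≤ ∑ a, (w a).1 * (w (σ a)).2} ≤
      ∫⁻ w, ENNReal.ofReal (Real.exp (t * (∑ a, (w a).1 * (w (σ a)).2 - ∑ a, (w a).1 * (w a).2)))
        ∂(Measure.pi fun _ : α => gaussianPair ρ) := by
    refine le_trans (measure_mono ?_) (le_trans (le_of_eq (one_mul _).symm) (mul_meas_ge_le_lintegral (by fun_prop) 1))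
    intro w hw
    simp only [Set.mem_ofPred_eq] at hw ⊢
    rw [ENNReal.one_le_ofReal]
    apply Real.one_le_exp
    have := sub_nonneg.2 hw
    positivity
  refine key.trans ?_
  rw [pi_gaussianPair, lintegral_map (by fun_prop) (by fun_prop), lintegral_prod _ (by fun_prop)]
  simp only
  have inner : ∀ x : α → ℝ, ∫⁻ z : α → ℝ, ENNReal.ofReal (Real.exp (t *
      (∑ a, x a * (ρ * x (σ a) + τ * z (σ a)) - ∑ a, x a * (ρ * x a + τ * z a))))
      ∂(Measure.pi fun _ : α => gaussianReal 0 1) =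
      ENNReal.ofReal (Real.exp (-s * ∑ a, (x a - x (σ a)) ^ 2)) := by
    intro x
    have e1 : ∑ a, x a * x (σ a) = ∑ a, x a ^ 2 - (∑ a, (x a - x (σ a)) ^ 2) / 2 := by
      have : ∑ a, x (σ a) ^ 2 = ∑ a, x a ^ 2 := Equiv.sum_comp σ (fun a => x a ^ 2)
      have e : ∑ a, (x a - x (σ a)) ^ 2 = ∑ a, x a ^ 2 - 2 * ∑ a, x a * x (σ a) + ∑ a, x (σ a) ^ 2 := by
        rw [Finset.mul_sum, ← Finset.sum_sub_distrib, ← Finset.sum_add_distrib]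
        exact Finset.sum_congr rfl fun a _ => by ring
      linarith
    have e2 : ∀ z : α → ℝ, ∑ a, x a * z (σ a) = ∑ a, x (σ.symm a) * z a := by
      intro z
      rw [← Equiv.sum_comp σ (fun a => x (σ.symm a) * z a)]
      simp
    have e3 : ∀ z : α → ℝ, t *
      (∑ a, x a * (ρ * x (σ a) + τ * z (σ a)) - ∑ a, x a * (ρ * x a + τ * z a)) =
      -(t * ρ / 2) * (∑ a, (x a - x (σ a)) ^ 2) + ∑ a, (t * τ * (x (σ.symm a) - x a)) * z a := by
      intro z
      have f1 : ∑ a, x a * (ρ * x (σ a) + τ * z (σ a)) = ρ * ∑ a, x a * x (σ a) + τ * ∑ a, x a * z (σ a) := by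
        rw [Finset.mul_sum, Finset.mul_sum, ← Finset.sum_add_distrib]
        exact Finset.sum_congr rfl fun a _ => by ring
      have f2 : ∑ a, x a * (ρ * x a + τ * z a) = ρ * ∑ a, x a ^ 2 + τ * ∑ a, x a * z a := by
        rw [Finset.mul_sum, Finset.mul_sum, ← Finset.sum_add_distrib]
        exact Finset.sum_congr rfl fun a _ => by ring
      have f3 : ∑ a, (t * τ * (x (σ.symm a) - x a)) * z a =
          t * τ * (∑ a, x (σ.symm a) * z a - ∑ a, x a * z a) := by
        rw [← Finset.sum_sub_distrib, Finset.mul_sum]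
        exact Finset.sum_congr rfl fun a _ => by ring
      rw [f1, f2, f3, e1, e2]
      ring
    simp_rw [e3, Real.exp_add, Real.exp_sum]
    simp_rw [ENNReal.ofReal_mul (Real.exp_pos _).le,
      ENNReal.ofReal_prod_of_nonneg (fun _ _ => (Real.exp_pos _).le)]
    rw [lintegral_const_mul _ (by fun_prop), lint_pi_prod (gaussianReal 0 1)
      (fun a g => ENNReal.ofReal (Real.exp (t * τ * (x (σ.symm a) - x a) * g))) (by fun_prop)]
    simp_rw [gauss_mgf]
    rw [← ENNReal.ofReal_prod_of_nonneg (fun _ _ => (Real.exp_pos _).le),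
      ← ENNReal.ofReal_mul (Real.exp_pos _).le, ← Real.exp_sum, ← Real.exp_add]
    congr 2
    have e4 : ∑ a, (t * τ * (x (σ.symm a) - x a)) ^ 2 / 2 =
        t ^ 2 * τ ^ 2 / 2 * ∑ a, (x a - x (σ a)) ^ 2 := by
      rw [← Equiv.sum_comp σ, Finset.mul_sum]
      refine Finset.sum_congr rfl fun a _ => ?_
      simp only [Equiv.symm_apply_apply]
      ring
    rw [e4, ht, hs]
    field_simp
    ring
  refine (lintegral_congr inner).trans_le ?_
  refine (gauss_D σ s hs0 S hS).trans ?_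
  rw [← ENNReal.ofReal_pow (by positivity)]
  apply ENNReal.ofReal_le_ofReal
  set L := Real.log (1 / (1 - ρ ^ 2)) with hL
  have hL0 : 0 ≤ L := Real.log_nonneg (by rw [le_div_iff₀ hv]; nlinarith)
  have hb : Real.exp (L / 4) ≤ 1 + 2 * s := by
    have h4 : (Real.exp (L / 4)) ^ 4 ≤ (1 + 2 * s) ^ 4 := by
      rw [← Real.exp_nat_mul]
      have : ((4 : ℕ) : ℝ) * (L / 4) = L := by push_cast; ring
      rw [this, hL, Real.exp_log (by positivity)]
      have e : 1 / (1 - ρ ^ 2) = 1 + 8 * s := by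
        rw [hs, hτ2]; field_simp; ring
      rw [e]
      nlinarith [sq_nonneg s, mul_nonneg hs0 hs0, mul_nonneg (mul_nonneg hs0 hs0) hs0, sq_nonneg (s^2)]
    exact le_of_pow_le_pow_left₀ (by norm_num) (by positivity) h4
  have hsq : (Real.sqrt (1 + 2 * s))⁻¹ ≤ Real.exp (-(L / 8)) := by
    rw [Real.exp_neg]
    apply inv_anti₀ (Real.exp_pos _)
    apply Real.le_sqrt_of_sq_le
    rw [← Real.exp_nat_mul]
    convert hb using 2
    push_cast; ring
  refine (pow_le_pow_left₀ (by positivity) hsq _).trans ?_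
  rw [← Real.exp_nat_mul]
  apply Real.exp_le_exp.2
  have : ((Finset.univ.filter fun a => σ a ≠ a).card : ℝ) ≤ 3 * S.card := by exact_mod_cast hcard
  nlinarith

lemma pi_featurePair (n d : ℕ) (r : ℝ) :
    (Measure.pi fun _ : Fin n => featurePair d r) =
    Measure.map (fun w : Fin n × Fin d → ℝ × ℝ => fun v =>
      ((fun i => (w (v, i)).1 : Fin d → ℝ), (fun i => (w (v, i)).2 : Fin d → ℝ)))
      (Measure.pi fun _ : Fin n × Fin d => gaussianPair r) := by
  have hm : Measurable (fun w : Fin d → ℝ × ℝ =>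
      ((fun i => (w i).1 : Fin d → ℝ), (fun i => (w i).2 : Fin d → ℝ))) := by fun_prop
  have h1 : featurePair d r = Measure.map (fun w : Fin d → ℝ × ℝ =>
      ((fun i => (w i).1 : Fin d → ℝ), (fun i => (w i).2 : Fin d → ℝ)))
      (Measure.pi fun _ : Fin d => gaussianPair r) := by
    rw [pi_gaussianPair, Measure.map_map hm (by fun_prop)]
    rfl
  have hp : IsProbabilityMeasure (Measure.map (fun w : Fin d → ℝ × ℝ =>
      ((fun i => (w i).1 : Fin d → ℝ), (fun i => (w i).2 : Fin d → ℝ)))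
      (Measure.pi fun _ : Fin d => gaussianPair r)) :=
    Measure.isProbabilityMeasure_map hm.aemeasurable
  rw [h1, ← Measure.pi_map_pi (μ := fun _ : Fin n => Measure.pi fun _ : Fin d => gaussianPair r)
    (hμ := fun _ => inferInstance) (fun _ => hm.aemeasurable)]
  have hc := Measure.infinitePi_map_curry (ι := Fin n) (κ := Fin d)
    (μ := fun _ _ => gaussianPair r)
  simp only [Measure.infinitePi_eq_pi] at hc
  rw [← hc, Measure.map_map (by fun_prop) (by fun_prop)]
  rfl

instance (d : ℕ) (r : ℝ) : IsProbabilityMeasure (featurePair d r) :=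
  Measure.isProbabilityMeasure_map (by fun_prop)

/-- the edge action as a permutation -/
def edgePerm {n : ℕ} (π : Equiv.Perm (Fin n)) : Equiv.Perm (Edge n) where
  toFun := edgeMap π
  invFun := edgeMap π⁻¹
  left_inv e := by
    apply Subtype.ext
    simp [edgeMap, Sym2.map_map]
  right_inv e := by
    apply Subtype.ext
    simp [edgeMap, Sym2.map_map]

/-- number of non-fixed points -/
def nf {n : ℕ} (τ : Equiv.Perm (Fin n)) : ℕ := (Finset.univ.filter fun v => τ v ≠ v).card

lemma edge_count {n : ℕ} (hn : 4 ≤ n) (τ : Equiv.Perm (Fin n)) :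
    (nf τ : ℝ) * n / 4 ≤ ((Finset.univ.filter fun e => edgePerm τ e ≠ e).card : ℝ) := by
  classical
  set M := (Finset.univ.filter fun e => edgePerm τ e ≠ e) with hM
  -- ordered pairs
  set P : Finset ((_ : Fin n) × Fin n) := (Finset.univ.filter fun v => τ v ≠ v).sigma
    (fun u => (Finset.univ.erase u).erase (τ u)) with hP
  have hPc : P.card = nf τ * (n - 2) := by
    rw [hP, Finset.card_sigma, nf, Finset.card_eq_sum_ones, Finset.sum_mul]
    refine Finset.sum_congr rfl fun u hu => ?_
    simp only [Finset.mem_filter, Finset.mem_univ, true_and] at hu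
    rw [Finset.card_erase_of_mem (by simp [hu]), Finset.card_erase_of_mem (by simp)]
    simp
    omega
  have h2 : P.card ≤ (M.map ⟨Subtype.val, Subtype.val_injective⟩).card * 2 := by
    refine (Finset.card_le_mul_card_image_of_maps_to (f := fun p : (_ : Fin n) × Fin n => s(p.1, p.2)) ?_ 2 ?_).trans
      (le_of_eq (mul_comm _ _))
    · rintro ⟨u, v⟩ hp
      simp only [hP, Finset.mem_sigma, Finset.mem_filter, Finset.mem_univ, true_and,
        Finset.mem_erase, and_true] at hp
      obtain ⟨hu, hv1, hv2⟩ := hp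
      simp only [Finset.mem_map, Function.Embedding.coeFn_mk, hM, Finset.mem_filter,
        Finset.mem_univ, true_and]
      refine ⟨⟨s(u, v), by simpa using hv2.symm⟩, ?_, rfl⟩
      intro h
      have := congrArg Subtype.val h
      simp only [edgePerm, edgeMap, Equiv.coe_fn_mk, Sym2.map_mk, Sym2.eq_iff] at this
      rcases this with ⟨h1, _⟩ | ⟨h1, _⟩
      · exact hu h1
      · exact hv1 h1.symm
    · intro e _
      induction e using Sym2.ind with
      | _ x y =>
        refine (Finset.card_le_card (t := {⟨x, y⟩, ⟨y, x⟩}) ?_).trans Finset.card_le_two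
        rintro ⟨u, v⟩ hp
        simp only [Finset.mem_filter, Sym2.eq_iff] at hp
        simp only [Finset.mem_insert, Finset.mem_singleton, Sigma.mk.injEq, heq_eq_eq]
        exact hp.2
  rw [Finset.card_map, hPc] at h2
  have h3 : ((nf τ : ℝ) * ((n : ℝ) - 2)) ≤ M.card * 2 := by
    have : ((nf τ * (n - 2) : ℕ) : ℝ) ≤ ((M.card * 2 : ℕ) : ℝ) := by exact_mod_cast h2
    push_cast [Nat.cast_sub (show 2 ≤ n by omega)] at this
    exact this
  have h4 : (4 : ℝ) ≤ n := by exact_mod_cast hn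
  have h5 : (0 : ℝ) ≤ nf τ := by positivity
  nlinarith

lemma vert_count {n d : ℕ} (τ : Equiv.Perm (Fin n)) :
    (nf τ : ℝ) * d = ((Finset.univ.filter fun a : Fin n × Fin d =>
      (τ.prodCongr (Equiv.refl (Fin d))) a ≠ a).card : ℝ) := by
  have : (Finset.univ.filter fun a : Fin n × Fin d =>
      (τ.prodCongr (Equiv.refl (Fin d))) a ≠ a) =
      (Finset.univ.filter fun v => τ v ≠ v) ×ˢ (Finset.univ : Finset (Fin d)) := by
    ext ⟨v, i⟩
    simp
  rw [this, Finset.card_product]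
  simp [nf]

lemma sum_perm_bound {n : ℕ} (hn : 1 ≤ n) :
    ∑ τ : Equiv.Perm (Fin n), ((n : ℝ) ^ (2 * nf τ))⁻¹ ≤ Real.exp 1 := by
  classical
  have hn0 : (0 : ℝ) < n := by exact_mod_cast hn
  set w : Fin n → Fin n → ℝ := fun v u => if u = v then 1 else ((n : ℝ) ^ 2)⁻¹ with hw
  have hw0 : ∀ v u, 0 ≤ w v u := by intro v u; simp only [hw]; split_ifs <;> positivity
  have e1 : ∀ τ : Equiv.Perm (Fin n), ((n : ℝ) ^ (2 * nf τ))⁻¹ = ∏ v, w v (τ v) := by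
    intro τ
    simp only [hw]
    rw [Finset.prod_ite]
    simp [nf, pow_mul]
  simp_rw [e1]
  calc _ = ∑ f ∈ Finset.univ.image (fun τ : Equiv.Perm (Fin n) => (τ : Fin n → Fin n)), ∏ v, w v (f v) := by
        rw [Finset.sum_image (fun a _ b _ h => DFunLike.coe_injective h)]
    _ ≤ ∑ f : Fin n → Fin n, ∏ v, w v (f v) :=
        Finset.sum_le_sum_of_subset_of_nonneg (Finset.subset_univ _)
          (fun f _ _ => Finset.prod_nonneg fun v _ => hw0 _ _)
    _ = ∏ v : Fin n, ∑ u : Fin n, w v u := (Fintype.prod_sum w).symm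
    _ ≤ ∏ v : Fin n, Real.exp (1 / n) := by
        apply Finset.prod_le_prod (fun v _ => Finset.sum_nonneg fun u _ => hw0 _ _)
        intro v _
        have : ∑ u, w v u ≤ 1 + n * ((n : ℝ) ^ 2)⁻¹ := by
          calc _ ≤ ∑ u, ((if u = v then 1 else 0) + ((n : ℝ) ^ 2)⁻¹) := by
                apply Finset.sum_le_sum
                intro u _
                simp only [hw]
                split_ifs
                · have : 0 ≤ ((n : ℝ) ^ 2)⁻¹ := by positivity
                  linarith
                · simp
            _ = _ := by simp [Finset.sum_add_distrib]
        refine this.trans ?_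
        have e : (n : ℝ) * ((n : ℝ) ^ 2)⁻¹ = 1 / n := by field_simp
        rw [e, add_comm]
        exact Real.add_one_le_exp _
    _ = Real.exp 1 := by
        rw [Finset.prod_const, ← Real.exp_nat_mul]
        simp [hn0.ne']

lemma pair_bound {n d : ℕ} (ρ r lam : ℝ) (hρ : 0 < ρ ∧ ρ < 1) (hr : 0 < r ∧ r < 1)
    (hl : 0 < lam ∧ lam < 1) (hn : 4 ≤ n)
    (hE : 288 * Real.log n ≤ n * Real.log (1 / (1 - ρ ^ 2)))
    (hV : 288 * Real.log n ≤ d * Real.log (1 / (1 - r ^ 2)))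
    (πs π : Equiv.Perm (Fin n)) :
    obsLaw n d ρ r πs {o | scoreLam lam o πs ≤ scoreLam lam o π} ≤
      ENNReal.ofReal (2 * ((n : ℝ) ^ (3 * nf (πs⁻¹ * π)))⁻¹) := by
  set τ := πs⁻¹ * π with hτ
  have hn0 : (0 : ℝ) < n := by exact_mod_cast (show 0 < n by omega)
  have hEd : ∀ (p q : Equiv.Perm (Fin n)) (e : Edge n), edgeMap p (edgeMap q e) = edgeMap (p * q) e := by
    intro p q e
    apply Subtype.ext
    simp [edgeMap, Sym2.map_map]
  have hE1 : ∀ e : Edge n, edgeMap 1 e = e := by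
    intro e
    apply Subtype.ext
    simp [edgeMap]
  have hm : Measurable (obsOf πs : _ → Obs n d) := by
    unfold obsOf
    fun_prop
  have hms : MeasurableSet {o : Obs n d | scoreLam lam o πs ≤ scoreLam lam o π} := by
    apply measurableSet_le <;> (unfold scoreLam; fun_prop)
  rw [obsLaw, Measure.map_apply hm hms]
  set A : Set (Edge n → ℝ × ℝ) := {w | ∑ a, (w a).1 * (w a).2 ≤ ∑ a, (w a).1 * (w (edgePerm τ a)).2} with hA
  set B : Set (Fin n → (Fin d → ℝ) × (Fin d → ℝ)) := 
    {w | ∑ v, ∑ i, (w v).1 i * (w v).2 i ≤ ∑ v, ∑ i, (w v).1 i * (w (τ v)).2 i} with hB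
  have hsub : obsOf πs ⁻¹' {o : Obs n d | scoreLam lam o πs ≤ scoreLam lam o π} ⊆
      (Prod.fst ⁻¹' A) ∪ (Prod.snd ⁻¹' B) := by
    rintro ⟨w1, w2⟩ hw
    by_contra hcon
    simp only [Set.mem_union, Set.mem_preimage, hA, hB, Set.mem_ofPred_eq, not_or, not_le] at hcon hw
    obtain ⟨c1, c2⟩ := hcon
    simp only [scoreLam, obsOf, hEd, inv_mul_cancel, hE1] at hw
    have d1 : ∀ v, πs⁻¹ (πs v) = v := by intro v; simp
    have d2 : ∀ v, πs⁻¹ (π v) = τ v := by intro v; simp [hτ]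
    simp only [d1, d2] at hw
    have c1' : ∑ a, (w1 a).1 * (w1 (edgeMap τ a)).2 < ∑ a, (w1 a).1 * (w1 a).2 := c1
    have m1 := mul_lt_mul_of_pos_left c1' hl.1
    have m2 := mul_lt_mul_of_pos_left c2 (sub_pos.2 hl.2)
    linarith
  refine (measure_mono hsub).trans ((measure_union_le _ _).trans ?_)
  have hmB : MeasurableSet B := by
    apply measurableSet_le <;> fun_prop
  have hpow : ((n : ℝ) ^ (3 * nf τ))⁻¹ = Real.exp (-(3 * nf τ * Real.log n)) := by
    rw [Real.exp_neg, mul_comm (3 * (nf τ : ℝ)), Real.exp_mul, Real.exp_log hn0]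
    congr 1
    rw [← Real.rpow_natCast]
    push_cast
    rfl
  have hk0 : (0 : ℝ) ≤ nf τ := by positivity
  have bA : (sample n d ρ r) (Prod.fst ⁻¹' A) ≤ ENNReal.ofReal (((n : ℝ) ^ (3 * nf τ))⁻¹) := by
    rw [← Set.prod_univ, sample, Measure.prod_prod, measure_univ, mul_one]
    refine (core (edgePerm τ) ρ hρ.1 hρ.2).trans ?_
    apply ENNReal.ofReal_le_ofReal
    rw [hpow]
    apply Real.exp_le_exp.2
    apply neg_le_neg
    have hc := edge_count hn τ
    have hL0 : 0 ≤ Real.log (1 / (1 - ρ ^ 2)) :=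
      Real.log_nonneg (by rw [le_div_iff₀ (by nlinarith)]; nlinarith)
    calc _ = (nf τ : ℝ) / 96 * (288 * Real.log n) := by ring
      _ ≤ (nf τ : ℝ) / 96 * (n * Real.log (1 / (1 - ρ ^ 2))) := by gcongr
      _ = (nf τ : ℝ) * n / 4 / 24 * Real.log (1 / (1 - ρ ^ 2)) := by ring
      _ ≤ _ := by gcongr
  have bB : (sample n d ρ r) (Prod.snd ⁻¹' B) ≤ ENNReal.ofReal (((n : ℝ) ^ (3 * nf τ))⁻¹) := by
    rw [← Set.univ_prod, sample, Measure.prod_prod, measure_univ, one_mul, pi_featurePair,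
      Measure.map_apply (by fun_prop) hmB]
    have := core (τ.prodCongr (Equiv.refl (Fin d))) r hr.1 hr.2
    rw [← vert_count] at this
    refine le_trans (le_trans (le_of_eq ?_) this) ?_
    · congr 1
      ext w
      simp only [hB, Set.mem_preimage, Set.mem_ofPred_eq, Fintype.sum_prod_type]
      rfl
    apply ENNReal.ofReal_le_ofReal
    rw [hpow]
    apply Real.exp_le_exp.2
    apply neg_le_neg
    have hlog : 0 ≤ Real.log n := Real.log_natCast_nonneg n
    calc _ ≤ (nf τ : ℝ) / 24 * (288 * Real.log n) := by nlinarith [mul_nonneg hk0 hlog]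
      _ ≤ (nf τ : ℝ) / 24 * (d * Real.log (1 / (1 - r ^ 2))) := by gcongr
      _ = _ := by ring
  refine (add_le_add bA bB).trans ?_
  rw [← ENNReal.ofReal_add (by positivity) (by positivity)]
  apply ENNReal.ofReal_le_ofReal
  linarith

lemma total_bound {n d : ℕ} (ρ r lam : ℝ) (hρ : 0 < ρ ∧ ρ < 1) (hr : 0 < r ∧ r < 1)
    (hl : 0 < lam ∧ lam < 1) (hn : 4 ≤ n)
    (hE : 288 * Real.log n ≤ n * Real.log (1 / (1 - ρ ^ 2)))
    (hV : 288 * Real.log n ≤ d * Real.log (1 / (1 - r ^ 2)))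
    (πs : Equiv.Perm (Fin n)) (est : Obs n d → Equiv.Perm (Fin n))
    (hest : ∀ o π', scoreLam lam o π' ≤ scoreLam lam o (est o)) :
    obsLaw n d ρ r πs {o | est o ≠ πs} ≤ ENNReal.ofReal (2 * Real.exp 1 / n) := by
  classical
  have hn1 : (1 : ℝ) ≤ n := by exact_mod_cast (show 1 ≤ n by omega)
  have hn0 : (0 : ℝ) < n := by linarith
  have hsub : {o : Obs n d | est o ≠ πs} ⊆
      ⋃ π ∈ Finset.univ.erase πs, {o | scoreLam lam o πs ≤ scoreLam lam o π} := by
    intro o ho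
    simp only [Set.mem_iUnion]
    exact ⟨est o, by simpa using ho, hest o πs⟩
  refine (measure_mono hsub).trans ((measure_biUnion_finset_le _ _).trans ?_)
  refine (Finset.sum_le_sum (fun π _ => pair_bound ρ r lam hρ hr hl hn hE hV πs π)).trans ?_
  rw [← ENNReal.ofReal_sum_of_nonneg (fun _ _ => by positivity)]
  apply ENNReal.ofReal_le_ofReal
  calc _ ≤ ∑ π ∈ Finset.univ.erase πs, 2 / n * ((n : ℝ) ^ (2 * nf (πs⁻¹ * π)))⁻¹ := by
        apply Finset.sum_le_sum
        intro π hπ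
        have hne : πs⁻¹ * π ≠ 1 := by
          intro h
          rw [inv_mul_eq_one] at h
          simp [h] at hπ
        have hk : 1 ≤ nf (πs⁻¹ * π) := by
          rw [Nat.one_le_iff_ne_zero]
          intro h
          apply hne
          ext v
          rw [nf, Finset.card_eq_zero, Finset.filter_eq_empty_iff] at h
          have := h (Finset.mem_univ v)
          rw [not_not] at this
          rw [this]; rfl
        have : (n : ℝ) * (n : ℝ) ^ (2 * nf (πs⁻¹ * π)) ≤ (n : ℝ) ^ (3 * nf (πs⁻¹ * π)) := by
          rw [← pow_succ']
          exact pow_le_pow_right₀ hn1 (by omega)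
        rw [div_mul_eq_mul_div, mul_div_assoc]
        gcongr
        rw [div_eq_mul_inv, ← mul_inv, mul_comm _ (n : ℝ)]
        exact inv_anti₀ (by positivity) this
    _ ≤ ∑ π : Equiv.Perm (Fin n), 2 / n * ((n : ℝ) ^ (2 * nf (πs⁻¹ * π)))⁻¹ :=
        Finset.sum_le_sum_of_subset_of_nonneg (Finset.subset_univ _) (fun _ _ _ => by positivity)
    _ = 2 / n * ∑ τ : Equiv.Perm (Fin n), ((n : ℝ) ^ (2 * nf τ))⁻¹ := by
        rw [← Finset.mul_sum]
        congr 1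
        exact Equiv.sum_comp (Equiv.mulLeft πs⁻¹) (fun τ => ((n : ℝ) ^ (2 * nf τ))⁻¹)
    _ ≤ 2 / n * Real.exp 1 := by
        have := sum_perm_bound (n := n) (by omega)
        gcongr
    _ = _ := by ring

/-- Proposition: recovery uniformly over `λ ∈ (δ, 1-δ)` under
the balance assumption `1/Γ ≤ Edge/Vertex ≤ Γ`. If `d = ω(log n)` and
`n log(1/(1-ρ²)) + d log(1/(1-r²)) ≥ C₀ log n` for a constant `C₀ = C₀(δ, Γ)`,
then for every `λ ∈ (δ, 1-δ)` the estimator `π̂_λ` maximizing the `λ`-weighted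
score satisfies `P[π̂_λ ≠ π*] = o(1)`. -/
theorem recovery_all_lambda
    (δ Γ : ℝ) (hδ : 0 < δ) (hδ' : δ < 1 / 2) :
    ∃ C0 : ℝ, ∀ (d : ℕ → ℕ) (ρ r : ℕ → ℝ),
      (∀ n, 0 < ρ n ∧ ρ n < 1) → (∀ n, 0 < r n ∧ r n < 1) →
      (∀ᶠ n : ℕ in atTop,
        1 / Γ ≤ ((n : ℝ) * Real.log (1 / (1 - ρ n ^ 2)))
            / ((d n : ℝ) * Real.log (1 / (1 - r n ^ 2))) ∧
        ((n : ℝ) * Real.log (1 / (1 - ρ n ^ 2)))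
            / ((d n : ℝ) * Real.log (1 / (1 - r n ^ 2))) ≤ Γ) →
      Tendsto (fun n => (d n : ℝ) / Real.log n) atTop atTop →
      (∀ n : ℕ, C0 * Real.log n ≤
        (n : ℝ) * Real.log (1 / (1 - ρ n ^ 2)) + (d n : ℝ) * Real.log (1 / (1 - r n ^ 2))) →
      ∀ πs : (n : ℕ) → Equiv.Perm (Fin n),
      ∀ lam : ℝ, δ < lam → lam < 1 - δ →
      ∀ est : (n : ℕ) → Obs n (d n) → Equiv.Perm (Fin n),
        (∀ n (o : Obs n (d n)) π', scoreLam lam o π' ≤ scoreLam lam o (est n o)) →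
        Tendsto
          (fun n => obsLaw n (d n) (ρ n) (r n) (πs n)
            {o : Obs n (d n) | est n o ≠ πs n})
          atTop (nhds 0) := by
  refine ⟨288 * (1 + Γ), ?_⟩
  intro d ρ r hρ hr hbal hd hC πs lam hl1 hl2 est hest
  have hlim : Tendsto (fun n : ℕ => ENNReal.ofReal (2 * Real.exp 1 / n)) atTop (nhds 0) := by
    have := ENNReal.tendsto_ofReal (tendsto_const_div_atTop_nhds_zero_nat (2 * Real.exp 1))
    simpa using this
  refine tendsto_of_tendsto_of_tendsto_of_le_of_le' tendsto_const_nhds hlim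
    (Eventually.of_forall fun _ => zero_le) ?_
  filter_upwards [hbal, hd.eventually_gt_atTop 0, eventually_ge_atTop 4] with n hb hdn hn
  have hn0 : (0 : ℝ) < n := by exact_mod_cast (show 0 < n by omega)
  have hd0 : (0 : ℝ) < d n := by
    rcases (Nat.cast_nonneg (d n) : (0 : ℝ) ≤ d n).lt_or_eq with h | h
    · exact h
    · rw [← h] at hdn; simp at hdn
  have hlog : ∀ x : ℝ, 0 < x ∧ x < 1 → 0 < Real.log (1 / (1 - x ^ 2)) := by
    intro x hx
    apply Real.log_pos
    rw [lt_div_iff₀ (by nlinarith [hx.1, hx.2])]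
    nlinarith [hx.1, hx.2]
  have hE := mul_pos hn0 (hlog _ (hρ n))
  have hV := mul_pos hd0 (hlog _ (hr n))
  have hCn := hC n
  set E := (n : ℝ) * Real.log (1 / (1 - ρ n ^ 2)) with hEdef
  set V := (d n : ℝ) * Real.log (1 / (1 - r n ^ 2)) with hVdef
  have hΓ : 0 < Γ := lt_of_lt_of_le (div_pos hE hV) hb.2
  have h1 : E ≤ Γ * V := (div_le_iff₀ hV).1 hb.2
  have h2 : V ≤ Γ * E := by
    have := hb.1
    rw [div_le_div_iff₀ hΓ hV] at this
    linarith
  refine total_bound (ρ n) (r n) lam (hρ n) (hr n) ⟨by linarith, by linarith⟩ hn ?_ ?_ (πs n) (est n)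
    (hest n)
  · have : (1 + Γ) * (288 * Real.log n) ≤ (1 + Γ) * E := by linarith
    exact le_of_mul_le_mul_left this (by linarith)
  · have : (1 + Γ) * (288 * Real.log n) ≤ (1 + Γ) * V := by linarith
    exact le_of_mul_le_mul_left this (by linarith)

end FCGW
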